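/- arXiv:2510.09899 — 3 statements merged into one kernel-verified Lean document; each statement's English description precedes it below -/
import Mathlib

section
/- Suppose q_s ∈ (0, 1) satisfies R = C·μ/(μ − q_s·λ)² (i.e., q_s is a critical point of the social welfare SW^S(q) = qλ(R − C/(μ − qλ))) and that the beliefs are unbiased in expected waiting time at q_s: 𝔼[1/(μ − q_s·Λ)] = 1/(μ − q_s·λ). If q_m ∈ [0, 1] satisfies Rev^S(q_m) ≥ Rev^S(q) for all q ∈ [0, 1], then q_m ≤ q_s. (Under unbiased expected waiting time, the revenue maximizer prefers a lower joining probability than the social optimizer: q^S_m ≤ q^S_s.) -/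
open MeasureTheory

/-- The waiting time `1 / (μ - qΛ)` is integrable when `Λ` is essentially bounded in `[a, b]`
with `0 ≤ a` and `b < μ`. -/
lemma integrable_waitingTime {Ω : Type*} [MeasurableSpace Ω] {P : Measure Ω} [IsFiniteMeasure P]
    {μ a b q : ℝ} (ha : 0 ≤ a) (hb : b < μ) {Λ : Ω → ℝ} (hΛ : Measurable Λ)
    (hbdd : ∀ᵐ ω ∂P, a ≤ Λ ω ∧ Λ ω ≤ b) (hq : q ∈ Set.Icc (0 : ℝ) 1) :
    Integrable (fun ω => 1 / (μ - q * Λ ω)) P := by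
  refine Integrable.of_bound (C := 1 / (μ - b)) (by measurability) ?_
  filter_upwards [hbdd] with ω hω
  have h1 : q * Λ ω ≤ Λ ω := mul_le_of_le_one_left (ha.trans hω.1) hq.2
  have h2 : 0 < μ - b := sub_pos.2 hb
  have h3 : μ - b ≤ μ - q * Λ ω := by linarith [hω.2]
  rw [Real.norm_of_nonneg (by have := h2.trans_le h3; positivity)]
  exact one_div_le_one_div_of_le h2 h3

/-- A strict tangent-type upper bound for the revenue at a fixed arrival rate `x`, linear in the
waiting time at `p`. -/
lemma revenue_le_tangent {μ R C a x p q t : ℝ} (hC : 0 < C) (ha : 0 < a) (hax : a ≤ x)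
    (hxμ : x < μ) (hp : 0 ≤ p) (hpq : p < q) (hq : q ≤ 1) :
    q * (R - C / (μ - q * x)) ≤ p * (R - C / (μ - p * x))
      + (q - p) * (R - C * μ * (2 * t * (1 / (μ - p * x)) - t ^ 2))
      - (q - p) ^ 2 * (C * a / μ ^ 2) := by
  have hx : 0 < x := ha.trans_le hax
  have hμ : 0 < μ := hx.trans hxμ
  have hu : 0 < μ - q * x := by nlinarith
  have hv : 0 < μ - p * x := by nlinarith
  have huμ : μ - q * x ≤ μ := by nlinarith
  have hvμ : μ - p * x ≤ μ := by nlinarith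
  set A := 1 / (μ - q * x) with hA
  set T := 1 / (μ - p * x) with hT
  have hA_ge : 1 / μ ≤ A := one_div_le_one_div_of_le hu huμ
  have hT_ge : 1 / μ ≤ T := one_div_le_one_div_of_le hv hvμ
  have hμ' : 0 < 1 / μ := by positivity
  have hdiff : q * A - p * T = μ * (q - p) * (T ^ 2 + (q - p) * (x * (A * T ^ 2))) := by
    have hA1 : A * (μ - q * x) = 1 := one_div_mul_cancel hu.ne'
    have hT1 : T * (μ - p * x) = 1 := one_div_mul_cancel hv.ne'
    linear_combination (p * T + μ * (q - p) * T ^ 2) * hA1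
      - (q * A + μ * (q - p) * (A * T)) * hT1
  have hprod : a * (1 / μ * (1 / μ) ^ 2) ≤ x * (A * T ^ 2) := by gcongr
  have hsq : 2 * t * T - t ^ 2 ≤ T ^ 2 := by nlinarith [sq_nonneg (T - t)]
  have hd : 0 < q - p := sub_pos.2 hpq
  have hlow : μ * (q - p) * ((2 * t * T - t ^ 2) + (q - p) * (a * (1 / μ * (1 / μ) ^ 2)))
      ≤ q * A - p * T := by
    rw [hdiff]
    gcongr
  have hmul := mul_le_mul_of_nonneg_left hlow hC.le
  have heq : C * a / μ ^ 2 = C * μ * (a * (1 / μ * (1 / μ) ^ 2)) := by field_simp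
  have e1 : C / (μ - q * x) = C * A := by rw [hA]; ring
  have e2 : C / (μ - p * x) = C * T := by rw [hT]; ring
  rw [e1, e2, heq]
  linarith

/-- If `q_s ∈ (0,1)` is a critical point of the social welfare
(`R = Cμ/(μ − q_s λ)²`), beliefs are unbiased in expected waiting time at `q_s`
(`𝔼[1/(μ − q_s Λ)] = 1/(μ − q_s λ)`), and `q_m ∈ [0,1]` maximizes the shared-belief
revenue `Rev^S(q) = qλ𝔼[R − C/(μ − qΛ)]` over `[0,1]`, then `q_m ≤ q_s`. -/
theorem stmt7
    {Ω : Type*} [MeasureSpace Ω] [IsProbabilityMeasure (volume : Measure Ω)]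
    (μ lam R C lamMin lamMax : ℝ)
    (hlam : 0 < lam) (hlamμ : lam < μ) (hC : 0 < C) (hR : C / μ ≤ R)
    (hMin : 0 < lamMin) (hMinMax : lamMin ≤ lamMax) (hMaxμ : lamMax < μ)
    (Λ : Ω → ℝ) (hΛ : Measurable Λ)
    (hbdd : ∀ᵐ ω, lamMin ≤ Λ ω ∧ Λ ω ≤ lamMax)
    (qs : ℝ) (hqs : qs ∈ Set.Ioo (0 : ℝ) 1)
    (hcrit : R = C * μ / (μ - qs * lam) ^ 2)
    (hunbiased : (∫ ω, 1 / (μ - qs * Λ ω)) = 1 / (μ - qs * lam))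
    (qm : ℝ) (hqm : qm ∈ Set.Icc (0 : ℝ) 1)
    (hqm_max : ∀ q ∈ Set.Icc (0 : ℝ) 1,
      q * lam * ∫ ω, (R - C / (μ - q * Λ ω)) ≤ qm * lam * ∫ ω, (R - C / (μ - qm * Λ ω))) :
    qm ≤ qs := by
  by_contra! hlt
  have hμ : 0 < μ := hlam.trans hlamμ
  have hqs' : qs ∈ Set.Icc (0 : ℝ) 1 := Set.Ioo_subset_Icc_self hqs
  have hden : 0 < μ - qs * lam := by nlinarith [hqs.2]
  have hW (q : ℝ) (hq : q ∈ Set.Icc (0 : ℝ) 1) : Integrable (fun ω => 1 / (μ - q * Λ ω)) :=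
    integrable_waitingTime hMin.le hMaxμ hΛ hbdd hq
  have hG (q : ℝ) (hq : q ∈ Set.Icc (0 : ℝ) 1) :
      Integrable (fun ω => R - C / (μ - q * Λ ω)) := by
    have hCW : Integrable (fun ω => C / (μ - q * Λ ω)) := by
      simpa only [mul_one_div] using (hW q hq).const_mul C
    exact (integrable_const R).sub hCW
  set t := 1 / (μ - qs * lam) with ht
  set δ := (qm - qs) ^ 2 * (C * lamMin / μ ^ 2) with hδ
  have hδ_pos : 0 < δ := by
    have := sub_pos.2 hlt
    positivity
  have hL : Integrable (fun ω => 2 * t * (1 / (μ - qs * Λ ω))) := (hW qs hqs').const_mul _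
  have hQ : Integrable (fun ω => C * μ * (2 * t * (1 / (μ - qs * Λ ω)) - t ^ 2)) :=
    (hL.sub (integrable_const (t ^ 2))).const_mul (C * μ)
  have hTi : Integrable
      (fun ω => (qm - qs) * (R - C * μ * (2 * t * (1 / (μ - qs * Λ ω)) - t ^ 2))) :=
    ((integrable_const R).sub hQ).const_mul (qm - qs)
  have hT0 : ∫ ω, (qm - qs) * (R - C * μ * (2 * t * (1 / (μ - qs * Λ ω)) - t ^ 2)) = 0 := by
    have hR' : R = C * μ * t ^ 2 := by rw [hcrit, ht]; field_simp
    rw [integral_const_mul, integral_sub (integrable_const R) hQ, integral_const_mul,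
      integral_sub hL (integrable_const _), integral_const_mul, hunbiased]
    simp only [integral_const, probReal_univ, one_smul]
    linear_combination (qm - qs) * hR'
  have hsum : Integrable (fun ω => qs * (R - C / (μ - qs * Λ ω))
      + (qm - qs) * (R - C * μ * (2 * t * (1 / (μ - qs * Λ ω)) - t ^ 2))) :=
    ((hG qs hqs').const_mul qs).add hTi
  have hle : (∫ ω, qm * (R - C / (μ - qm * Λ ω))) ≤
      ∫ ω, (qs * (R - C / (μ - qs * Λ ω))
        + (qm - qs) * (R - C * μ * (2 * t * (1 / (μ - qs * Λ ω)) - t ^ 2)) - δ) := by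
    refine integral_mono_ae ((hG qm hqm).const_mul qm)
      (hsum.sub (integrable_const δ)) ?_
    filter_upwards [hbdd] with ω hω
    exact revenue_le_tangent hC hMin hω.1 (hω.2.trans_lt hMaxμ) hqs.1.le hlt hqm.2
  rw [integral_sub hsum (integrable_const δ),
    integral_add ((hG qs hqs').const_mul qs) hTi, hT0, integral_const_mul, integral_const_mul,
    integral_const, probReal_univ, one_smul] at hle
  have hmax := hqm_max qs hqs'
  nlinarith [mul_le_mul_of_nonneg_left hle hlam.le, mul_pos hlam hδ_pos]
end

section
/- Assume λ > 𝔼[Λ]. Then there exists q₀ > 0 with q₀·max{λ, λ_max} < μ such that for every q ∈ (0, q₀), 𝔼[W_G(q·Λ)] < W_G(q·λ); equivalently, for every price p and such q, the shared-belief revenue rate q·λ·𝔼[R − C·W_G(qΛ)] strictly exceeds the classical revenue rate q·λ·(R − C·W_G(qλ)). -/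
open MeasureTheory

/-- The M/G/1 expected waiting time at effective arrival rate `x`. -/
noncomputable def WG (μ s x : ℝ) : ℝ := 1 / μ + s ^ 2 * x / (2 * (1 - x / μ))

theorem WG_le_of_le {μ s x y : ℝ} (hμ : 0 < μ) (hx : 0 ≤ x) (hxy : x ≤ y) (hy : y < μ) :
    WG μ s x ≤ 1 / μ + s ^ 2 * x / (2 * (1 - y / μ)) := by
  have hpos : 0 < 1 - y / μ := sub_pos.2 ((div_lt_one hμ).2 hy)
  unfold WG
  gcongr

theorem le_WG {μ s x : ℝ} (hμ : 0 < μ) (hx : 0 ≤ x) (hxμ : x < μ) :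
    1 / μ + s ^ 2 * x / 2 ≤ WG μ s x := by
  have hpos : 0 < 1 - x / μ := sub_pos.2 ((div_lt_one hμ).2 hxμ)
  have hle : 2 * (1 - x / μ) ≤ 2 := by
    have := div_nonneg hx hμ.le
    linarith
  unfold WG
  gcongr

theorem measurable_WG (μ s : ℝ) : Measurable (WG μ s) := by
  unfold WG
  fun_prop

theorem integrable_WG_comp {Ω : Type*} [MeasurableSpace Ω] {P : Measure Ω} [IsFiniteMeasure P]
    {μ s b : ℝ} {X : Ω → ℝ} (hμ : 0 < μ) (hX : AEMeasurable X P)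
    (hbdd : ∀ᵐ ω ∂P, 0 ≤ X ω ∧ X ω ≤ b) (hb : b < μ) :
    Integrable (fun ω => WG μ s (X ω)) P := by
  refine Integrable.of_bound ((measurable_WG μ s).comp_aemeasurable hX).aestronglyMeasurable
    (1 / μ + s ^ 2 * b / (2 * (1 - b / μ))) ?_
  filter_upwards [hbdd] with ω hω
  have hlow := le_WG (s := s) hμ hω.1 (hω.2.trans_lt hb)
  have hnonneg : 0 ≤ 1 / μ + s ^ 2 * X ω / 2 := by
    have := hω.1
    positivity
  rw [Real.norm_of_nonneg (hnonneg.trans hlow)]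
  refine (WG_le_of_le hμ hω.1 hω.2 hb).trans ?_
  have hpos : 0 < 1 - b / μ := sub_pos.2 ((div_lt_one hμ).2 hb)
  have := hω.2
  gcongr

/-- If `λ > 𝔼[Λ]`, then for all sufficiently small `q > 0` we have
`𝔼[W_G(qΛ)] < W_G(qλ)`; equivalently, for every price `p` and such `q`, the
shared-belief revenue rate `qλ𝔼[R − C·W_G(qΛ)]` strictly exceeds the classical
revenue rate `qλ(R − C·W_G(qλ))`. -/
theorem stmt10
    {Ω : Type*} [MeasureSpace Ω] [IsProbabilityMeasure (volume : Measure Ω)]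
    (μ lam R C s lamMin lamMax : ℝ)
    (hμ : 0 < μ) (hlam : 0 < lam) (hC : 0 < C) (hs : 0 < s)
    (hMin : 0 < lamMin) (hMinMax : lamMin ≤ lamMax) (hMaxμ : lamMax < μ)
    (Λ : Ω → ℝ) (hΛ : Measurable Λ)
    (hbdd : ∀ᵐ ω, lamMin ≤ Λ ω ∧ Λ ω ≤ lamMax)
    (hmean : (∫ ω, Λ ω) < lam) :
    ∃ q₀ > (0 : ℝ), q₀ * max lam lamMax < μ ∧
      ∀ q, 0 < q → q < q₀ →
        (∫ ω, WG μ s (q * Λ ω)) < WG μ s (q * lam) ∧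
        ∀ _p : ℝ,
          q * lam * (R - C * WG μ s (q * lam)) <
            q * lam * ∫ ω, (R - C * WG μ s (q * Λ ω)) := by
  have hmax : 0 < max lam lamMax := lt_max_of_lt_left hlam
  have hMax : 0 < lamMax := hMin.trans_le hMinMax
  have hΛint : Integrable Λ := by
    refine Integrable.of_bound hΛ.aestronglyMeasurable lamMax ?_
    filter_upwards [hbdd] with ω hω
    rw [Real.norm_of_nonneg (hMin.le.trans hω.1)]
    exact hω.2
  set m := ∫ ω, Λ ω
  refine ⟨min (μ / (2 * max lam lamMax)) ((lam - m) * μ / (lam * lamMax)),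
    lt_min (by positivity) (div_pos (mul_pos (sub_pos.2 hmean) hμ) (by positivity)), ?_, ?_⟩
  · calc _ ≤ μ / (2 * max lam lamMax) * max lam lamMax := by gcongr; exact min_le_left _ _
      _ = μ / 2 := by field_simp
      _ < μ := half_lt_self hμ
  intro q hq hq₀
  obtain ⟨hq₁, hq₂⟩ := lt_min_iff.1 hq₀
  have hqmax : q * max lam lamMax < μ := by
    rw [lt_div_iff₀ (by positivity)] at hq₁
    nlinarith [mul_pos hq hmax]
  have hqlam : q * lam < μ := lt_of_le_of_lt (by gcongr; exact le_max_left _ _) hqmax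
  have hqMax : q * lamMax < μ := lt_of_le_of_lt (by gcongr; exact le_max_right _ _) hqmax
  have hpos : 0 < 1 - q * lamMax / μ := sub_pos.2 ((div_lt_one hμ).2 hqMax)
  have hm : m < lam * (1 - q * lamMax / μ) := by
    rw [lt_div_iff₀ (by positivity)] at hq₂
    have : lam * (q * lamMax / μ) < lam - m := by
      rw [← mul_div_assoc, div_lt_iff₀ hμ]
      linarith
    linarith
  have hqbdd : ∀ᵐ ω, 0 ≤ q * Λ ω ∧ q * Λ ω ≤ q * lamMax := by
    filter_upwards [hbdd] with ω hω
    exact ⟨mul_nonneg hq.le (hMin.le.trans hω.1), mul_le_mul_of_nonneg_left hω.2 hq.le⟩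
  have hWint : Integrable (fun ω => WG μ s (q * Λ ω)) :=
    integrable_WG_comp hμ (hΛ.const_mul q).aemeasurable hqbdd hqMax
  have hlt : (∫ ω, WG μ s (q * Λ ω)) < WG μ s (q * lam) := by
    calc (∫ ω, WG μ s (q * Λ ω))
        ≤ ∫ ω, (1 / μ + s ^ 2 * q / (2 * (1 - q * lamMax / μ)) * Λ ω) := by
          refine integral_mono_ae hWint ((integrable_const _).add (hΛint.const_mul _)) ?_
          filter_upwards [hqbdd] with ω hω
          refine (WG_le_of_le hμ hω.1 hω.2 hqMax).trans_eq ?_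
          ring
      _ = 1 / μ + s ^ 2 * q / 2 * (m / (1 - q * lamMax / μ)) := by
          rw [integral_add (integrable_const _) (hΛint.const_mul _), integral_const_mul]
          simp only [integral_const, probReal_univ, one_smul]
          congr 1
          field_simp
          rfl
      _ < 1 / μ + s ^ 2 * q / 2 * lam := by
          gcongr
          exact (div_lt_iff₀ hpos).2 hm
      _ = 1 / μ + s ^ 2 * (q * lam) / 2 := by ring
      _ ≤ WG μ s (q * lam) := le_WG hμ (by positivity) hqlam
  refine ⟨hlt, fun _ => ?_⟩
  rw [integral_sub (integrable_const _) (hWint.const_mul C), integral_const_mul]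
  simp only [integral_const, probReal_univ, one_smul]
  gcongr
end

section
/- Suppose 0 < ξ ≤ λ_min and q_S ∈ [0, 1] satisfies the shared-belief equilibrium condition 𝔼[W_G(q_S·Λ)] = W_G(ξ). Then q_S·𝔼[Λ] ≤ ξ and q_S ≤ ξ·𝔼[1/Λ]; consequently, for every price p ≥ 0, the shared-belief revenue p·λ·q_S is at most the private-belief revenue p·λ·ξ·𝔼[1/Λ]. (When the threshold effective arrival rate is below every belief, Rev^S(p) ≤ Rev^P(p).) -/
open MeasureTheory

theorem WG_eq {μ : ℝ} (hμ : 0 < μ) (s : ℝ) {x : ℝ} (hx : x < μ) :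
    WG μ s x = 1 / μ + s ^ 2 / 2 * (μ ^ 2 / (μ - x) - μ) := by
  have h : μ - x ≠ 0 := (sub_pos.2 hx).ne'
  have h' : 1 - x / μ = (μ - x) / μ := by field_simp
  unfold WG
  rw [h']
  field_simp
  ring

/-- The tangent line of `y ↦ 1 / y` at `b` lies below its graph on the positive half-line. -/
theorem inv_tangent_le {a b : ℝ} (ha : 0 < a) (hb : 0 < b) : 2 / b - a / b ^ 2 ≤ 1 / a := by
  have h : 1 / a - (2 / b - a / b ^ 2) = (a - b) ^ 2 / (a * b ^ 2) := by
    field_simp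
    ring
  have : 0 ≤ (a - b) ^ 2 / (a * b ^ 2) := by positivity
  linarith

/-- The tangent line of the M/G/1 waiting time at `ξ` lies below its graph. -/
theorem WG_tangent_le {μ : ℝ} (hμ : 0 < μ) (s : ℝ) {x ξ : ℝ} (hx : x < μ) (hξ : ξ < μ) :
    WG μ s ξ + s ^ 2 / 2 * (μ ^ 2 / (μ - ξ) ^ 2) * (x - ξ) ≤ WG μ s x := by
  have hb : 0 < μ - ξ := sub_pos.2 hξ
  rw [WG_eq hμ s hx, WG_eq hμ s hξ]
  have h := mul_le_mul_of_nonneg_left (inv_tangent_le (sub_pos.2 hx) hb)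
    (by positivity : 0 ≤ s ^ 2 / 2 * μ ^ 2)
  have e : s ^ 2 / 2 * μ ^ 2 * (2 / (μ - ξ) - (μ - x) / (μ - ξ) ^ 2) =
      s ^ 2 / 2 * (μ ^ 2 / (μ - ξ)) + s ^ 2 / 2 * (μ ^ 2 / (μ - ξ) ^ 2) * (x - ξ) := by
    field_simp
    ring
  have e' : s ^ 2 / 2 * μ ^ 2 * (1 / (μ - x)) = s ^ 2 / 2 * (μ ^ 2 / (μ - x)) := by ring
  linarith

theorem monotoneOn_WG {μ : ℝ} (hμ : 0 < μ) (s : ℝ) : MonotoneOn (WG μ s) (Set.Iio μ) := by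
  intro x hx y hy hxy
  rw [WG_eq hμ s hx, WG_eq hμ s hy]
  have : 0 < μ - y := sub_pos.2 hy
  gcongr

/-- An almost surely bounded real random variable has an integrable composition with any
measurable function that is monotone on the range. -/
theorem integrable_comp_of_monotoneOn {Ω : Type*} [MeasurableSpace Ω] {P : Measure Ω}
    [IsFiniteMeasure P] {X : Ω → ℝ} (hX : Measurable X) {a b : ℝ}
    (hab : ∀ᵐ ω ∂P, a ≤ X ω ∧ X ω ≤ b) {f : ℝ → ℝ} (hf : Measurable f)
    (hmono : MonotoneOn f (Set.Icc a b)) : Integrable (fun ω => f (X ω)) P := by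
  refine Integrable.of_mem_Icc (f a) (f b) (hf.comp hX).aemeasurable ?_
  filter_upwards [hab] with ω hω
  have h := hω.1.trans hω.2
  exact ⟨hmono ⟨le_rfl, h⟩ hω hω.1, hmono hω ⟨h, le_rfl⟩ hω.2⟩

/-- If `0 < ξ ≤ λ_min` and `q_S ∈ [0,1]` satisfies the shared-belief equilibrium
condition `𝔼[W_G(q_S Λ)] = W_G(ξ)`, then `q_S·𝔼[Λ] ≤ ξ` and `q_S ≤ ξ·𝔼[1/Λ]`;
consequently, for every price `p ≥ 0`, `pλq_S ≤ pλξ𝔼[1/Λ]`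
(i.e. `Rev^S(p) ≤ Rev^P(p)`). -/
theorem stmt14
    {Ω : Type*} [MeasureSpace Ω] [IsProbabilityMeasure (volume : Measure Ω)]
    (μ lam C R s lamMin lamMax : ℝ)
    (hlam : 0 < lam) (hlamμ : lam < μ) (hC : 0 < C) (hs : 0 < s)
    (hMin : 0 < lamMin) (hMinMax : lamMin ≤ lamMax) (hMaxμ : lamMax < μ)
    (Λ : Ω → ℝ) (hΛ : Measurable Λ)
    (hbdd : ∀ᵐ ω, lamMin ≤ Λ ω ∧ Λ ω ≤ lamMax)
    (ξ : ℝ) (hξ0 : 0 < ξ) (hξ : ξ ≤ lamMin)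
    (qS : ℝ) (hqS : qS ∈ Set.Icc (0 : ℝ) 1)
    (heq : (∫ ω, WG μ s (qS * Λ ω)) = WG μ s ξ) :
    qS * (∫ ω, Λ ω) ≤ ξ ∧ qS ≤ ξ * (∫ ω, 1 / Λ ω) ∧
      ∀ p : ℝ, 0 ≤ p → p * lam * qS ≤ p * lam * (ξ * ∫ ω, 1 / Λ ω) := by
  have hμ : 0 < μ := hlam.trans hlamμ
  have hξμ : ξ < μ := (hξ.trans hMinMax).trans_lt hMaxμ
  obtain ⟨hq0, hq1⟩ := hqS
  have hΛi : Integrable Λ :=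
    integrable_comp_of_monotoneOn (f := fun x => x) hΛ hbdd measurable_id
      (monotone_id.monotoneOn _)
  have hinv : Integrable (fun ω => 1 / Λ ω) := by
    refine Integrable.of_mem_Icc (1 / lamMax) (1 / lamMin) (by fun_prop) ?_
    filter_upwards [hbdd] with ω hω
    have hpos : 0 < Λ ω := hMin.trans_le hω.1
    exact ⟨one_div_le_one_div_of_le hpos hω.2, one_div_le_one_div_of_le hMin hω.1⟩
  have hlt : ∀ x, lamMin ≤ x ∧ x ≤ lamMax → qS * x < μ := fun x hx =>
    ((mul_le_of_le_one_left (hMin.le.trans hx.1) hq1).trans hx.2).trans_lt hMaxμ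
  have hWi : Integrable (fun ω => WG μ s (qS * Λ ω)) :=
    integrable_comp_of_monotoneOn (f := fun x => WG μ s (qS * x)) hΛ hbdd
      ((measurable_WG μ s).comp (measurable_const_mul qS)) fun x hx y hy hxy =>
        monotoneOn_WG hμ s (hlt x hx) (hlt y hy) (mul_le_mul_of_nonneg_left hxy hq0)
  have hslope : 0 < s ^ 2 / 2 * (μ ^ 2 / (μ - ξ) ^ 2) := by
    have := sub_pos.2 hξμ
    positivity
  have hmean : qS * (∫ ω, Λ ω) ≤ ξ := by
    have hle : (∫ ω, (WG μ s ξ + s ^ 2 / 2 * (μ ^ 2 / (μ - ξ) ^ 2) * (qS * Λ ω - ξ))) ≤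
        ∫ ω, WG μ s (qS * Λ ω) := by
      refine integral_mono_ae (by fun_prop) hWi ?_
      filter_upwards [hbdd] with ω hω using WG_tangent_le hμ s (hlt _ hω) hξμ
    rw [integral_add (by fun_prop) (by fun_prop), integral_const_mul,
      integral_sub (by fun_prop) (by fun_prop), integral_const_mul, heq] at hle
    simp only [integral_const, probReal_univ, one_smul] at hle
    have := nonpos_of_mul_nonpos_right (add_le_iff_nonpos_right _ |>.1 hle) hslope
    linarith
  have hmpos : 0 < ∫ ω, Λ ω := by
    have hle : (∫ _ : Ω, lamMin) ≤ ∫ ω, Λ ω :=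
      integral_mono_ae (by fun_prop) hΛi (hbdd.mono fun ω hω => hω.1)
    simp only [integral_const, probReal_univ, one_smul] at hle
    exact hMin.trans_le hle
  have hjensen : 1 / (∫ ω, Λ ω) ≤ ∫ ω, 1 / Λ ω := by
    set m := ∫ ω, Λ ω with hm
    have hle : (∫ ω, (2 / m - Λ ω / m ^ 2)) ≤ ∫ ω, 1 / Λ ω := by
      refine integral_mono_ae (by fun_prop) hinv ?_
      filter_upwards [hbdd] with ω hω using inv_tangent_le (hMin.trans_le hω.1) hmpos
    rw [integral_sub (by fun_prop) (by fun_prop),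
      integral_div (m ^ 2) Λ, ← hm] at hle
    simp only [integral_const, probReal_univ, one_smul] at hle
    have e : 2 / m - m / m ^ 2 = 1 / m := by
      field_simp
      ring
    rwa [e] at hle
  have hq : qS ≤ ξ * ∫ ω, 1 / Λ ω := by
    calc qS ≤ ξ / ∫ ω, Λ ω := (le_div_iff₀ hmpos).2 hmean
      _ = ξ * (1 / ∫ ω, Λ ω) := div_eq_mul_one_div _ _
      _ ≤ ξ * ∫ ω, 1 / Λ ω := mul_le_mul_of_nonneg_left hjensen hξ0.le
  exact ⟨hmean, hq, fun p hp => mul_le_mul_of_nonneg_left hq (by positivity)⟩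
end
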